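/- Let G = (N, v) be a characteristic function game with |N| = n ≥ 2. The Exchange Value admits the closed coalition-sum form: for every agent i ∈ N, EV_i(G) = Σ_{C ⊆ N∖{i}, |C| ≤ n−2} (|C|! · (n − 1 − |C|)! / ((n−1)! · (n−1))) · v(C ∪ {i}) − Σ_{C ⊆ N∖{i}, C ≠ ∅} (|C|! · (n − 1 − |C|)! / ((n−1)! · (n−1))) · v(C). In particular, v(N) does not appear in the expression for EV_i(G), and v(N∖{i}) appears with total coefficient −1/(n−1). -/

import Mathlib

open Finset

/-- The set of all permutations (encoded as lists) of the elements of a finset `s`.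
For a nodup base list this is exactly the set `Π_s` of orderings of `s`. -/
noncomputable def permsOf {α : Type*} [DecidableEq α] (s : Finset α) : Finset (List α) :=
  s.toList.permutations.toFinset

/-- The Shapley Value of agent `i` in the characteristic function game on the
(full, finite) agent set `α` with characteristic function `v`:
`SV_i = (1/n!) ∑_{m=0}^{n-1} ∑_{π ∈ Π_{N∖{i}}} (v (S_π(m) ∪ {i}) - v (S_π(m)))`,
where `S_π(m)` is the set of the first `m` entries of `π`. -/
noncomputable def ShapleyValue {α : Type*} [Fintype α] [DecidableEq α]
    (v : Finset α → ℝ) (i : α) : ℝ :=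
  (((Fintype.card α).factorial : ℝ))⁻¹ *
    ∑ π ∈ permsOf (Finset.univ.erase i), ∑ m ∈ Finset.range (Fintype.card α),
      (v (insert i (π.take m).toFinset) - v (π.take m).toFinset)

/-- The Exchange Value of agent `i`:
`EV_i = (1/((n-1)!·(n-1))) ∑_{m=1}^{n-1} ∑_{π ∈ Π_{N∖{i}}} (v (S_π(m-1) ∪ {i}) - v (S_π(m)))`. -/
noncomputable def ExchangeValue {α : Type*} [Fintype α] [DecidableEq α]
    (v : Finset α → ℝ) (i : α) : ℝ :=
  ((((Fintype.card α - 1).factorial * (Fintype.card α - 1) : ℕ) : ℝ))⁻¹ *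
    ∑ π ∈ permsOf (Finset.univ.erase i), ∑ m ∈ Finset.Icc 1 (Fintype.card α - 1),
      (v (insert i (π.take (m - 1)).toFinset) - v (π.take m).toFinset)

theorem mem_permsOf {α : Type*} [DecidableEq α] {s : Finset α} {l : List α} :
    l ∈ permsOf s ↔ l.Nodup ∧ l.toFinset = s := by
  rw [permsOf, List.mem_toFinset, List.mem_permutations]
  constructor
  · intro h
    exact ⟨h.nodup_iff.2 s.nodup_toList, by rw [List.toFinset_eq_of_perm _ _ h, toList_toFinset]⟩
  · rintro ⟨h, rfl⟩
    exact (List.toFinset_toList h).symm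

theorem card_permsOf {α : Type*} [DecidableEq α] (s : Finset α) :
    (permsOf s).card = s.card.factorial := by
  rw [permsOf, List.toFinset_card_of_nodup (List.nodup_permutations _ s.nodup_toList),
    List.length_permutations, length_toList]

theorem length_of_mem_permsOf {α : Type*} [DecidableEq α] {s : Finset α} {l : List α}
    (hl : l ∈ permsOf s) : l.length = s.card := by
  obtain ⟨h, rfl⟩ := mem_permsOf.1 hl
  exact (List.toFinset_card_of_nodup h).symm

/-- The orderings of `s` that begin with the elements of `C ⊆ s` number `|C|! (|s| - |C|)!`. -/
theorem card_permsOf_filter_take {α : Type*} [DecidableEq α] {s C : Finset α} (hC : C ⊆ s) :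
    ((permsOf s).filter fun π => (π.take C.card).toFinset = C).card =
      C.card.factorial * (s.card - C.card).factorial := by
  rw [← card_sdiff_of_subset hC, ← card_permsOf, ← card_permsOf, ← card_product]
  symm
  refine card_bij' (fun p _ => p.1 ++ p.2) (fun π _ => (π.take C.card, π.drop C.card)) ?_ ?_ ?_ ?_
  · rintro ⟨a, b⟩ h
    obtain ⟨ha, hb⟩ := mem_product.1 h
    have hlen := length_of_mem_permsOf ha
    obtain ⟨ha, ha'⟩ := mem_permsOf.1 ha
    obtain ⟨hb, hb'⟩ := mem_permsOf.1 hb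
    dsimp only at *
    rw [mem_filter, mem_permsOf, ← hlen, List.take_left, List.toFinset_append, ha', hb',
      union_sdiff_of_subset hC, List.nodup_append']
    refine ⟨⟨⟨ha, hb, ?_⟩, rfl⟩, rfl⟩
    rw [← List.disjoint_toFinset_iff_disjoint, ha', hb']
    exact disjoint_sdiff
  · intro π h
    obtain ⟨h, hC'⟩ := mem_filter.1 h
    obtain ⟨hnd, hs⟩ := mem_permsOf.1 h
    rw [← List.take_append_drop C.card π, List.nodup_append'] at hnd
    rw [← List.take_append_drop C.card π, List.toFinset_append, hC'] at hs
    obtain ⟨h1, h2, h3⟩ := hnd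
    rw [← List.disjoint_toFinset_iff_disjoint, hC'] at h3
    refine mem_product.2 ⟨mem_permsOf.2 ⟨h1, hC'⟩, mem_permsOf.2 ⟨h2, ?_⟩⟩
    rw [← hs, union_sdiff_cancel_left h3]
  · rintro ⟨a, b⟩ h
    have hlen := length_of_mem_permsOf (mem_product.1 h).1
    dsimp only at *
    rw [← hlen, List.take_left, List.drop_left]
  · intro π _
    exact List.take_append_drop _ _

theorem sum_permsOf_take {α : Type*} [DecidableEq α] (s : Finset α) {m : ℕ} (hm : m ≤ s.card)
    (f : Finset α → ℝ) :
    ∑ π ∈ permsOf s, f (π.take m).toFinset =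
      ∑ C ∈ s.powersetCard m,
        ((C.card.factorial * (s.card - C.card).factorial : ℕ) : ℝ) * f C := by
  have hmaps : ∀ π ∈ permsOf s, (π.take m).toFinset ∈ s.powersetCard m := by
    intro π h
    have hlen := length_of_mem_permsOf h
    obtain ⟨hnd, rfl⟩ := mem_permsOf.1 h
    rw [mem_powersetCard, List.toFinset_card_of_nodup (hnd.sublist (List.take_sublist _ _)),
      List.length_take, hlen]
    refine ⟨fun x hx => ?_, min_eq_left hm⟩
    exact List.mem_toFinset.2 (List.mem_of_mem_take (List.mem_toFinset.1 hx))
  rw [← sum_fiberwise_of_maps_to hmaps]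
  refine sum_congr rfl fun C hC => ?_
  obtain ⟨hCs, rfl⟩ := mem_powersetCard.1 hC
  rw [← card_permsOf_filter_take hCs, ← nsmul_eq_mul, ← sum_const]
  exact sum_congr rfl fun π hπ => by rw [(mem_filter.1 hπ).2]

/-- The Exchange Value admits the closed coalition-sum form:
`EV_i(G) = ∑_{C ⊆ N∖{i}, |C| ≤ n−2} (|C|!(n−1−|C|)!/((n−1)!(n−1))) v(C ∪ {i})
          − ∑_{C ⊆ N∖{i}, C ≠ ∅} (|C|!(n−1−|C|)!/((n−1)!(n−1))) v(C)`.
In particular `v(N)` never occurs in either sum (every `C ∪ {i}` in the first sum has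
size at most `n−1` and every `C` in the second has size at most `n−1`), and `v(N∖{i})`
appears (in the second sum) with total coefficient `−1/(n−1)`, as stated by the second
conjunct. -/
theorem exchangeValue_eq_coalition_sum
    {α : Type*} [Fintype α] [DecidableEq α]
    (hn : 2 ≤ Fintype.card α) (v : Finset α → ℝ) (hv : v ∅ = 0) (i : α) :
    (ExchangeValue v i =
      ∑ C ∈ (Finset.univ.erase i).powerset.filter (fun C => C.card ≤ Fintype.card α - 2),
        (((C.card.factorial * (Fintype.card α - 1 - C.card).factorial : ℕ) : ℝ) /
            (((Fintype.card α - 1).factorial * (Fintype.card α - 1) : ℕ) : ℝ)) *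
          v (insert i C)
      - ∑ C ∈ (Finset.univ.erase i).powerset.filter (fun C => C ≠ ∅),
          (((C.card.factorial * (Fintype.card α - 1 - C.card).factorial : ℕ) : ℝ) /
              (((Fintype.card α - 1).factorial * (Fintype.card α - 1) : ℕ) : ℝ)) * v C)
    ∧ ((((Finset.univ.erase i).card.factorial *
            (Fintype.card α - 1 - (Finset.univ.erase i).card).factorial : ℕ) : ℝ) /
          (((Fintype.card α - 1).factorial * (Fintype.card α - 1) : ℕ) : ℝ)
        = 1 / ((Fintype.card α : ℝ) - 1)) := by
  have hcard : (Finset.univ.erase i).card = Fintype.card α - 1 := by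
    rw [card_erase_of_mem (mem_univ i), card_univ]
  generalize hs : Finset.univ.erase i = s at *
  constructor
  · rw [ExchangeValue, hs, sum_comm]
    simp only [sum_sub_distrib, div_eq_inv_mul, mul_assoc, ← mul_sum]
    rw [← mul_sub]
    congr 2
    · have hmaps : ∀ C ∈ s.powerset.filter (fun C => C.card ≤ Fintype.card α - 2),
          C.card + 1 ∈ Icc 1 (Fintype.card α - 1) := by
        intro C hC
        have := (mem_filter.1 hC).2
        rw [mem_Icc]
        omega
      rw [← sum_fiberwise_of_maps_to hmaps]
      refine sum_congr rfl fun m hm => ?_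
      rw [mem_Icc] at hm
      rw [sum_permsOf_take s (by omega) fun C => v (insert i C), hcard]
      refine sum_congr ?_ fun _ _ => rfl
      ext C
      simp only [mem_filter, mem_powerset, mem_powersetCard, and_assoc]
      refine and_congr_right fun _ => ?_
      omega
    · have hmaps : ∀ C ∈ s.powerset.filter (fun C => C ≠ ∅),
          C.card ∈ Icc 1 (Fintype.card α - 1) := by
        intro C hC
        obtain ⟨hCs, hne⟩ := mem_filter.1 hC
        rw [mem_Icc, ← hcard]
        exact ⟨card_pos.2 (nonempty_iff_ne_empty.2 hne), card_le_card (mem_powerset.1 hCs)⟩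
      rw [← sum_fiberwise_of_maps_to hmaps]
      refine sum_congr rfl fun m hm => ?_
      rw [mem_Icc] at hm
      rw [sum_permsOf_take s (by omega) v, hcard]
      refine sum_congr ?_ fun _ _ => rfl
      ext C
      simp only [mem_filter, mem_powerset, mem_powersetCard, and_assoc]
      refine and_congr_right fun _ => ?_
      rw [ne_eq, ← card_eq_zero]
      omega
  · rw [hcard, Nat.sub_self, Nat.factorial_zero, mul_one, Nat.cast_mul, Nat.cast_sub (by omega),
      Nat.cast_one, ← div_div, div_self (Nat.cast_ne_zero.2 (Nat.factorial_ne_zero _))]
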